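/- Let S > 0 and C > 0 be real numbers, and let b : [1,∞) → [0,∞) satisfy b(tT) ≥ t^{−S} (b(T) − C/T) for all T ≥ 1 and all t ≥ 1. If sup_{T ≥ 1} T·b(T) = ∞, then there exist a constant C' > 0 and T₀ ≥ 1 such that b(T) ≥ C' T^{−S} for all T ≥ T₀. -/

import Mathlib

/-- Abstract lower-bound argument (equation (1.5)): if `b : [1,∞) → [0,∞)` satisfies
`b (tT) ≥ t^{-S} (b T - C/T)` for all `T ≥ 1`, `t ≥ 1`, and `sup_{T ≥ 1} T · b T = ∞`,
then `b T ≥ C' T^{-S}` for some `C' > 0` and all sufficiently large `T`. -/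
theorem coefficient_lower_bound (S C : ℝ) (hS : 0 < S) (hC : 0 < C)
    (b : ℝ → ℝ) (hb : ∀ T : ℝ, 1 ≤ T → 0 ≤ b T)
    (hrec : ∀ T : ℝ, 1 ≤ T → ∀ t : ℝ, 1 ≤ t → b (t * T) ≥ t ^ (-S) * (b T - C / T))
    (hsup : ∀ M : ℝ, ∃ T : ℝ, 1 ≤ T ∧ M ≤ T * b T) :
    ∃ C' : ℝ, 0 < C' ∧ ∃ T₀ : ℝ, 1 ≤ T₀ ∧ ∀ T : ℝ, T₀ ≤ T → b T ≥ C' * T ^ (-S) := by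
  obtain ⟨R, hR, hRb⟩ := hsup (C + 1)
  have hR0 : 0 < R := by linarith
  have hgap : 0 < b R - C / R := by
    rw [sub_pos, div_lt_iff₀ hR0]
    linarith
  refine ⟨R ^ S * (b R - C / R), by positivity, R, hR, fun T hT => ?_⟩
  have hT0 : 0 < T := hR0.trans_le hT
  have h := hrec R hR (T / R) ((one_le_div hR0).2 hT)
  rw [div_mul_cancel₀ T hR0.ne', Real.div_rpow hT0.le hR0.le, Real.rpow_neg hR0.le,
    div_inv_eq_mul] at h
  linarith
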